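/- Let G be a finite connected graph, let k be a positive integer, let u and v be two adjacent extreme vertices of G, and let S be a k-distance mutual-visibility set of G of maximum cardinality (i.e. |S| = μ_k(G)). Then u ∈ S if and only if v ∈ S. -/

import Mathlib

open SimpleGraph

/-- Two vertices `x, y` are `S_k`-visible in `G`: there is a shortest `x,y`-path of length
at most `k` none of whose internal vertices lies in `S`. -/
def SKVisible {V : Type*} (G : SimpleGraph V) (S : Set V) (k : ℕ) (x y : V) : Prop :=
  ∃ p : G.Walk x y, p.IsPath ∧ p.length = G.dist x y ∧ p.length ≤ k ∧
    ∀ v ∈ p.support, v ∈ S → v = x ∨ v = y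

/-- `S` is a `k`-distance mutual-visibility set of `G`. -/
def IsKDistMutualVisSet {V : Type*} (G : SimpleGraph V) (k : ℕ) (S : Set V) : Prop :=
  ∀ ⦃x⦄, x ∈ S → ∀ ⦃y⦄, y ∈ S → SKVisible G S k x y

/-- The `k`-distance mutual-visibility number `μ_k(G)`. -/
noncomputable def kdistMu {V : Type*} (G : SimpleGraph V) (k : ℕ) : ℕ :=
  sSup {n | ∃ S : Finset V, IsKDistMutualVisSet G k ↑S ∧ S.card = n}

/-- Two vertices `x, y` are `S`-visible in `G`. -/
def SVisible {V : Type*} (G : SimpleGraph V) (S : Set V) (x y : V) : Prop :=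
  ∃ p : G.Walk x y, p.IsPath ∧ p.length = G.dist x y ∧
    ∀ v ∈ p.support, v ∈ S → v = x ∨ v = y

/-- `S` is a mutual-visibility set of `G`. -/
def IsMutualVisSet {V : Type*} (G : SimpleGraph V) (S : Set V) : Prop :=
  ∀ ⦃x⦄, x ∈ S → ∀ ⦃y⦄, y ∈ S → SVisible G S x y

/-- The mutual-visibility number `μ(G)`. -/
noncomputable def mutualVisNum {V : Type*} (G : SimpleGraph V) : ℕ :=
  sSup {n | ∃ S : Finset V, IsMutualVisSet G ↑S ∧ S.card = n}

/-- A vertex is extreme if its closed neighborhood induces a complete graph. -/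
def IsExtremeVertex {V : Type*} (G : SimpleGraph V) (u : V) : Prop :=
  ∀ ⦃x y : V⦄, G.Adj u x → G.Adj u y → x ≠ y → G.Adj x y

/-- The concatenation of two nontrivial walks leaving an extreme vertex is not shortest. -/
lemma IsExtremeVertex.dist_lt {V : Type*} {G : SimpleGraph V} {v x y : V}
    (hv : IsExtremeVertex G v) (p : G.Walk v x) (q : G.Walk v y) (hx : v ≠ x) (hy : v ≠ y) :
    G.dist x y < p.length + q.length := by
  cases p with
  | nil => exact absurd rfl hx
  | @cons _ a _ ha p =>
    cases q with
    | nil => exact absurd rfl hy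
    | @cons _ b _ hb q =>
      by_cases hab : a = b
      · subst hab
        have := dist_le (p.reverse.append q)
        simp only [Walk.length_append, Walk.length_reverse, Walk.length_cons] at this ⊢
        omega
      · have := dist_le (p.reverse.append (Walk.cons (hv ha hb hab) q))
        simp only [Walk.length_append, Walk.length_reverse, Walk.length_cons] at this ⊢
        omega

/-- An extreme vertex is never an internal vertex of a shortest walk. -/
lemma IsExtremeVertex.eq_or_eq_of_mem_support {V : Type*} {G : SimpleGraph V} {v x y : V}
    (hv : IsExtremeVertex G v) (p : G.Walk x y) (hp : p.length = G.dist x y)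
    (hmem : v ∈ p.support) : v = x ∨ v = y := by
  classical
  by_contra! h
  have hlt := hv.dist_lt (p.takeUntil v hmem).reverse (p.dropUntil v hmem) h.1 h.2
  have hlen := congrArg Walk.length (p.take_spec hmem)
  rw [Walk.length_append] at hlen
  rw [Walk.length_reverse] at hlt
  omega

lemma IsExtremeVertex.dist_le_of_adj {V : Type*} {G : SimpleGraph V} (hG : G.Connected)
    {u v y : V} (hv : IsExtremeVertex G v) (huv : G.Adj u v) (hy : v ≠ y) :
    G.dist u y ≤ G.dist v y := by
  obtain ⟨p, hp⟩ := hG.exists_walk_length_eq_dist v y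
  rw [← hp]
  cases p with
  | nil => exact absurd rfl hy
  | @cons _ w _ hw q =>
    by_cases hwu : u = w
    · subst hwu
      exact (dist_le q).trans (by simp)
    · exact dist_le (Walk.cons (hv huv.symm hw hwu) q)

lemma SKVisible.symm {V : Type*} {G : SimpleGraph V} {S : Set V} {k : ℕ} {x y : V}
    (h : SKVisible G S k x y) : SKVisible G S k y x := by
  obtain ⟨p, hp, hd, hk, hS⟩ := h
  refine ⟨p.reverse, hp.reverse, by rw [Walk.length_reverse, hd, dist_comm],
    by rwa [Walk.length_reverse], fun w hw hwS => ?_⟩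
  rw [Walk.support_reverse, List.mem_reverse] at hw
  exact (hS w hw hwS).symm

lemma SKVisible.insert_of_isExtremeVertex {V : Type*} {G : SimpleGraph V} {S : Set V} {k : ℕ}
    {v x y : V} (h : SKVisible G S k x y) (hv : IsExtremeVertex G v) :
    SKVisible G (insert v S) k x y := by
  obtain ⟨p, hp, hd, hk, hS⟩ := h
  refine ⟨p, hp, hd, hk, fun w hw hwS => ?_⟩
  rcases hwS with rfl | hwS
  · exact hv.eq_or_eq_of_mem_support p hd hw
  · exact hS w hw hwS

/-- Visibility is transferred from an extreme vertex to an adjacent extreme vertex. -/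
lemma SKVisible.of_adj_of_isExtremeVertex {V : Type*} {G : SimpleGraph V} (hG : G.Connected)
    {S : Set V} {k : ℕ} {u v y : V} (h : SKVisible G S k u y) (huv : G.Adj u v)
    (hu : IsExtremeVertex G u) (hv : IsExtremeVertex G v) (huy : u ≠ y) (hvy : v ≠ y) :
    SKVisible G S k v y := by
  obtain ⟨p, hp, hd, hk, hS⟩ := h
  have hvp : v ∉ p.support := fun hmem =>
    (hv.eq_or_eq_of_mem_support p hd hmem).elim huv.ne' hvy
  have hdist : G.dist u y = G.dist v y :=
    le_antisymm (hv.dist_le_of_adj hG huv hvy) (hu.dist_le_of_adj hG huv.symm huy)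
  cases p with
  | nil => exact absurd rfl huy
  | @cons _ w _ hw q =>
    rw [Walk.cons_isPath_iff] at hp
    rw [Walk.support_cons, List.mem_cons, not_or] at hvp
    have hvw : v ≠ w := fun e => hvp.2 (e ▸ q.start_mem_support)
    refine ⟨Walk.cons (hu huv hw hvw) q, hp.1.cons hvp.2, hd.trans hdist, hk,
      fun z hz hzS => ?_⟩
    rw [Walk.support_cons, List.mem_cons] at hz
    rcases hz with rfl | hz
    · exact Or.inl rfl
    · rcases hS z (by simp [hz]) hzS with rfl | rfl
      · exact absurd hz hp.2
      · exact Or.inr rfl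

lemma SKVisible.refl {V : Type*} (G : SimpleGraph V) (S : Set V) (k : ℕ) (x : V) :
    SKVisible G S k x x :=
  ⟨Walk.nil, by simp, by simp, by simp, by simp⟩

lemma SKVisible.of_adj {V : Type*} {G : SimpleGraph V} (S : Set V) {k : ℕ} (hk : 1 ≤ k)
    {x y : V} (h : G.Adj x y) : SKVisible G S k x y :=
  ⟨h.toWalk, by simp [h.ne], by simp [dist_eq_one_iff_adj.mpr h], by simpa using hk,
    by simp +contextual⟩

lemma IsKDistMutualVisSet.insert_of_adj {V : Type*} {G : SimpleGraph V} (hG : G.Connected)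
    {S : Set V} {k : ℕ} (hk : 1 ≤ k) {u v : V} (huv : G.Adj u v)
    (hu : IsExtremeVertex G u) (hv : IsExtremeVertex G v)
    (hS : IsKDistMutualVisSet G k S) (huS : u ∈ S) : IsKDistMutualVisSet G k (insert v S) := by
  have key : ∀ y ∈ S, SKVisible G (insert v S) k v y := by
    intro y hy
    by_cases hvy : v = y
    · subst hvy
      exact .refl ..
    by_cases huy : u = y
    · subst huy
      exact .of_adj _ hk huv.symm
    exact ((hS huS hy).insert_of_isExtremeVertex hv).of_adj_of_isExtremeVertex
      hG huv hu hv huy hvy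
  intro x hx y hy
  rcases hx with rfl | hx <;> rcases hy with rfl | hy
  · exact .refl ..
  · exact key y hy
  · exact (key x hx).symm
  · exact (hS hx hy).insert_of_isExtremeVertex hv

lemma IsKDistMutualVisSet.card_le_kdistMu {V : Type*} [Fintype V] {G : SimpleGraph V} {k : ℕ}
    {S : Finset V} (hS : IsKDistMutualVisSet G k ↑S) : S.card ≤ kdistMu G k := by
  refine le_csSup ⟨Fintype.card V, ?_⟩ ⟨S, hS, rfl⟩
  rintro _ ⟨T, -, rfl⟩
  exact T.card_le_univ

lemma IsKDistMutualVisSet.mem_of_adj {V : Type*} [Fintype V] {G : SimpleGraph V}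
    (hG : G.Connected) {k : ℕ} (hk : 1 ≤ k) {u v : V} (huv : G.Adj u v)
    (hu : IsExtremeVertex G u) (hv : IsExtremeVertex G v)
    {S : Finset V} (hS : IsKDistMutualVisSet G k ↑S) (hmax : S.card = kdistMu G k)
    (huS : u ∈ S) : v ∈ S := by
  classical
  by_contra hvS
  have hins : IsKDistMutualVisSet G k ↑(insert v S) := by
    rw [Finset.coe_insert]
    exact hS.insert_of_adj hG hk huv hu hv huS
  have hle := hins.card_le_kdistMu
  rw [Finset.card_insert_of_notMem hvS] at hle
  omega

/-- If `u, v` are adjacent extreme vertices of a finite connected graph `G` and `S` is a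
`k`-distance mutual-visibility set of maximum cardinality, then `u ∈ S ↔ v ∈ S`. -/
theorem stmt4 {V : Type*} [Fintype V] (G : SimpleGraph V) (hG : G.Connected)
    (k : ℕ) (hk : 1 ≤ k) (u v : V) (huv : G.Adj u v)
    (hu : IsExtremeVertex G u) (hv : IsExtremeVertex G v)
    (S : Finset V) (hS : IsKDistMutualVisSet G k ↑S) (hmax : S.card = kdistMu G k) :
    u ∈ S ↔ v ∈ S := by
  exact ⟨hS.mem_of_adj hG hk huv hu hv hmax, hS.mem_of_adj hG hk huv.symm hv hu hmax⟩
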